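/- Let G : (W,‖·‖_W) → (V,‖·‖_V) be an operator between two normed spaces satisfying the growth condition ‖∂G‖(ν) ≤ A e^{γ‖ν‖_W} for all ν ∈ W, where A, γ > 0. Then for all w, w′ ∈ W one has the two-point estimate ‖G(w) − G(w′)‖_V ≤ A e^{γ‖w‖_W + γ‖w′‖_W} ‖w − w′‖_W. -/

import Mathlib

open Filter Topology
open scoped ENNReal

/-- The local variation of an operator `G` between normed spaces at a point `w`:
`‖∂G‖(w) := limsup_{h→0, h≠0} ‖G(w+h) − G(w)‖ / ‖h‖`, a value in `[0,+∞]`. -/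
noncomputable def locVar {W V : Type*} [NormedAddCommGroup W] [NormedAddCommGroup V]
    (G : W → V) (w : W) : ℝ≥0∞ :=
  Filter.limsup (fun h : W => ENNReal.ofReal (‖G (w + h) - G w‖ / ‖h‖)) (𝓝[≠] (0 : W))

/-- An upper bound on the local variation controls increments near the point. -/
theorem eventually_norm_sub_le_of_locVar_lt {W V : Type*} [NormedAddCommGroup W]
    [NormedAddCommGroup V] {G : W → V} {w : W} {C : ℝ} (h : locVar G w < ENNReal.ofReal C) :
    ∀ᶠ y in 𝓝 w, ‖G y - G w‖ ≤ C * ‖y - w‖ := by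
  have hev : ∀ᶠ k in 𝓝 (0 : W), k ≠ 0 →
      ENNReal.ofReal (‖G (w + k) - G w‖ / ‖k‖) < ENNReal.ofReal C :=
    eventually_nhdsWithin_iff.mp (eventually_lt_of_limsup_lt h)
  have htend : Tendsto (fun y : W => y - w) (𝓝 w) (𝓝 0) := by
    have hc : Continuous fun y : W => y - w := by fun_prop
    simpa using hc.tendsto w
  filter_upwards [htend.eventually hev] with y hy
  rcases eq_or_ne y w with rfl | hne
  · simp
  · have hlt := (ENNReal.ofReal_lt_ofReal_iff'.mp (hy (sub_ne_zero.mpr hne))).1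
    rw [add_sub_cancel, div_lt_iff₀ (norm_sub_pos_iff.mpr hne)] at hlt
    exact hlt.le

/-- An operator is continuous wherever its local variation is finite. -/
theorem continuousAt_of_locVar_ne_top {W V : Type*} [NormedAddCommGroup W]
    [NormedAddCommGroup V] {G : W → V} {w : W} (h : locVar G w ≠ ∞) : ContinuousAt G w := by
  have hlt : locVar G w < ENNReal.ofReal ((locVar G w).toReal + 1) := by
    rw [ENNReal.lt_ofReal_iff_toReal_lt h]
    exact lt_add_one _
  rw [ContinuousAt, tendsto_iff_norm_sub_tendsto_zero]
  refine squeeze_zero' (.of_forall fun _ => norm_nonneg _)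
    (eventually_norm_sub_le_of_locVar_lt hlt) ?_
  have hc : Continuous fun y : W => ((locVar G w).toReal + 1) * ‖y - w‖ := by fun_prop
  simpa using hc.tendsto w

/-- Mean value inequality: a bound on the local variation along a segment is a Lipschitz bound
for its endpoints. -/
theorem norm_sub_le_of_locVar_le_segment {W V : Type*} [NormedAddCommGroup W] [NormedSpace ℝ W]
    [NormedAddCommGroup V] {G : W → V} {M : ℝ} (hM : 0 ≤ M) {w w' : W}
    (h : ∀ ν ∈ segment ℝ w' w, locVar G ν ≤ ENNReal.ofReal M) :
    ‖G w - G w'‖ ≤ M * ‖w - w'‖ := by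
  rcases eq_or_ne w w' with rfl | hne
  · simp
  have hd : 0 < ‖w - w'‖ := norm_sub_pos_iff.mpr hne
  set p : ℝ → W := fun t => w' + t • (w - w') with hp
  have hpc : Continuous p := by fun_prop
  have hseg : ∀ t ∈ Set.Icc (0 : ℝ) 1, locVar G (p t) ≤ ENNReal.ofReal M := fun t ht =>
    h _ (by rw [segment_eq_image']; exact ⟨t, ht, rfl⟩)
  have hcont : ContinuousOn (fun t => ‖G (p t) - G w'‖) (Set.Icc 0 1) := fun t ht => by
    have hG : ContinuousAt G (p t) :=
      continuousAt_of_locVar_ne_top ((hseg t ht).trans_lt ENNReal.ofReal_lt_top).ne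
    have hGp : ContinuousAt (fun s => G (p s)) t := ContinuousAt.comp hG hpc.continuousAt
    exact (hGp.sub continuousAt_const).norm.continuousWithinAt
  have key := image_le_of_liminf_slope_right_le_deriv_boundary
    (B := fun t => M * ‖w - w'‖ * t) (B' := fun _ => M * ‖w - w'‖) hcont
    (by simp [hp]) (by fun_prop)
    (fun x _ => by simpa using ((hasDerivAt_id x).const_mul (M * ‖w - w'‖)).hasDerivWithinAt)
    (fun x hx r hr => by
      obtain ⟨C, hMC, hCr⟩ := exists_between ((lt_div_iff₀ hd).mpr hr)
      have hlt : locVar G (p x) < ENNReal.ofReal C :=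
        (hseg x ⟨hx.1, hx.2.le⟩).trans_lt
          ((ENNReal.ofReal_lt_ofReal_iff (hM.trans_lt hMC)).mpr hMC)
      have hev := (hpc.tendsto x).eventually (eventually_norm_sub_le_of_locVar_lt hlt)
      refine Eventually.frequently ?_
      filter_upwards [hev.filter_mono nhdsWithin_le_nhds, self_mem_nhdsWithin] with z hz hxz
      have hzx : 0 < z - x := sub_pos.mpr hxz
      have hsub : p z - p x = (z - x) • (w - w') := by simp only [hp]; module
      rw [hsub, norm_smul, Real.norm_of_nonneg hzx.le] at hz
      rw [slope_def_field, div_lt_iff₀ hzx]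
      have htri := norm_sub_norm_le (G (p z) - G w') (G (p x) - G w')
      rw [sub_sub_sub_cancel_right] at htri
      have hCr' : C * ‖w - w'‖ < r := (lt_div_iff₀ hd).mp hCr
      nlinarith [mul_lt_mul_of_pos_right hCr' hzx])
    (Set.right_mem_Icc.mpr zero_le_one)
  simpa [hp] using key

/-- If `‖∂G‖(ν) ≤ A e^{γ‖ν‖}` for all `ν`, with `A, γ > 0`, then for all
`w, w′` one has the two-point estimate
`‖G(w) − G(w′)‖ ≤ A e^{γ‖w‖ + γ‖w′‖} ‖w − w′‖`. -/
theorem stmt_7 {W V : Type*} [NormedAddCommGroup W] [NormedSpace ℝ W] [NormedAddCommGroup V]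
    (G : W → V) (A γ : ℝ) (hA : 0 < A) (hγ : 0 < γ)
    (h : ∀ ν : W, locVar G ν ≤ ENNReal.ofReal (A * Real.exp (γ * ‖ν‖))) :
    ∀ w w' : W, ‖G w - G w'‖ ≤ A * Real.exp (γ * ‖w‖ + γ * ‖w'‖) * ‖w - w'‖ := by
  intro w w'
  refine norm_sub_le_of_locVar_le_segment (by positivity) fun ν hν => (h ν).trans ?_
  have hmax : ‖ν‖ ≤ max ‖w'‖ ‖w‖ := (convexOn_norm convex_univ).le_max_of_mem_segment
    (Set.mem_univ _) (Set.mem_univ _) hν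
  have hle : ‖ν‖ ≤ ‖w‖ + ‖w'‖ := hmax.trans
    (max_le (le_add_of_nonneg_left (norm_nonneg _)) (le_add_of_nonneg_right (norm_nonneg _)))
  rw [← mul_add]
  gcongr
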